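/- For every real α > 1 there exists a constant C = C(α) > 0 such that the following holds. For every positive integer t, every ε, δ ∈ (0,1), every bounded interval I = [a,b] ⊆ ℝ, and every n ≥ C·(α·t + log(1/δ))/ε², there exists a measurable estimator A : Iⁿ → {functions h : I → ℝ} whose output is always piecewise constant with at most 2αt interval pieces, such that for every probability density function f on I, with probability at least 1 − δ over X_1, …, X_n drawn i.i.d. from the distribution with density f, the hypothesis h = A(X_1, …, X_n) satisfies ∫_I |h − f| ≤ 2·OPT_t(f) + (4·OPT_t(f) + 4ε)/(α − 1) + ε. -/

import Mathlib

open MeasureTheory Set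

/-- `f` is a probability density function on `I`. -/
def IsPDFOn (f : ℝ → ℝ) (I : Set ℝ) : Prop :=
  (∀ x ∈ I, 0 ≤ f x) ∧ IntegrableOn f I ∧ (∫ x in I, f x) = 1

/-- The measure on `ℝ` with density `f` on `I`. -/
noncomputable def densityMeasure (I : Set ℝ) (f : ℝ → ℝ) : Measure ℝ :=
  (volume.restrict I).withDensity fun x => ENNReal.ofReal (f x)

/-- `h` is a `t`-histogram on `I`: there is a partition of `I` into at most `t` intervals
on each of which `h` is constant. -/
def IsHistogram (I : Set ℝ) (t : ℕ) (h : ℝ → ℝ) : Prop :=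
  ∃ P : Fin t → Set ℝ,
    (∀ i, (P i).OrdConnected) ∧
    (Pairwise fun i j => Disjoint (P i) (P j)) ∧
    (⋃ i, P i) = I ∧
    ∀ i, ∃ cst : ℝ, ∀ x ∈ P i, h x = cst

/-- `OPT_t(f)`: the infimum of `∫_I |g − f|` over all `t`-histogram probability density
functions `g` on `I`. -/
noncomputable def OPThist (I : Set ℝ) (t : ℕ) (f : ℝ → ℝ) : ℝ :=
  sInf { y : ℝ | ∃ g : ℝ → ℝ, IsHistogram I t g ∧ IsPDFOn g I ∧
    y = ∫ x in I, |g x - f x| }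

/-- The deviation of the empirical measure of the sample `X` from `ν` on the set `S`. -/
noncomputable def empDev (ν : Measure ℝ) {n : ℕ} (X : Fin n → ℝ) (S : Set ℝ) : ℝ :=
  (∑ k, S.indicator (1 : ℝ → ℝ) (X k)) / n - ν.real S

lemma measurable_empDev (ν : Measure ℝ) {n : ℕ} {S : Set ℝ} (hS : MeasurableSet S) :
    Measurable fun X : Fin n → ℝ => empDev ν X S := by
  unfold empDev
  have : Measurable (S.indicator (1 : ℝ → ℝ)) := measurable_one.indicator hS
  fun_prop

lemma integral_exp_indicator_le (ν : Measure ℝ) [IsProbabilityMeasure ν] {S : Set ℝ}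
    (hS : MeasurableSet S) {l : ℝ} (hl : |l| ≤ 1) :
    ∫ x, Real.exp (l * S.indicator (1 : ℝ → ℝ) x) ∂ν ≤ Real.exp (ν.real S * (l + l ^ 2)) := by
  have h1 : ∀ x, Real.exp (l * S.indicator (1 : ℝ → ℝ) x) =
      1 + S.indicator (fun _ => Real.exp l - 1) x := by
    intro x
    by_cases hx : x ∈ S <;> simp [hx]
  simp_rw [h1]
  rw [integral_add (integrable_const _) ((integrable_const _).indicator hS),
    integral_indicator hS]
  simp only [integral_const, probReal_univ, smul_eq_mul, one_mul, MeasurableSet.univ,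
    measureReal_restrict_apply, univ_inter]
  have h2 : Real.exp l - 1 ≤ l + l ^ 2 := by
    have := (abs_le.1 (Real.abs_exp_sub_one_sub_id_le hl)).2
    linarith
  calc 1 + ν.real S * (Real.exp l - 1) ≤ 1 + ν.real S * (l + l ^ 2) := by gcongr
    _ ≤ _ := by linarith [Real.add_one_le_exp (ν.real S * (l + l ^ 2))]

lemma mgf_sum_indicator_le (ν : Measure ℝ) [IsProbabilityMeasure ν] (n : ℕ) {S : Set ℝ}
    (hS : MeasurableSet S) {l : ℝ} (hl : |l| ≤ 1) :
    ProbabilityTheory.mgf (fun X : Fin n → ℝ => ∑ k, S.indicator (1 : ℝ → ℝ) (X k))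
      (Measure.pi fun _ => ν) l ≤ Real.exp (n * (ν.real S * (l + l ^ 2))) := by
  unfold ProbabilityTheory.mgf
  have h := integral_fintype_prod_eq_pow (ι := Fin n) (μ := ν)
    (fun x => Real.exp (l * S.indicator (1 : ℝ → ℝ) x))
  simp_rw [Finset.mul_sum, Real.exp_sum]
  rw [h, Fintype.card_fin, Real.exp_nat_mul]
  gcongr
  exact integral_exp_indicator_le ν hS hl

lemma integrable_exp_mul_sum_indicator (ν : Measure ℝ) [IsProbabilityMeasure ν] (n : ℕ)
    {S : Set ℝ} (hS : MeasurableSet S) (l : ℝ) :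
    Integrable (fun X : Fin n → ℝ => Real.exp (l * ∑ k, S.indicator (1 : ℝ → ℝ) (X k)))
      (Measure.pi fun _ => ν) := by
  have hm : Measurable (S.indicator (1 : ℝ → ℝ)) := measurable_one.indicator hS
  have hm' : Measurable fun X : Fin n → ℝ =>
      Real.exp (l * ∑ k, S.indicator (1 : ℝ → ℝ) (X k)) := by fun_prop
  refine Integrable.of_bound hm'.aestronglyMeasurable (Real.exp (|l| * n)) (ae_of_all _ fun X => ?_)
  rw [Real.norm_eq_abs, Real.abs_exp]
  have h0 : 0 ≤ ∑ k, S.indicator (1 : ℝ → ℝ) (X k) :=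
    Finset.sum_nonneg fun k _ => indicator_nonneg (by simp) _
  have h1 : ∑ k, S.indicator (1 : ℝ → ℝ) (X k) ≤ n := by
    calc ∑ k, S.indicator (1 : ℝ → ℝ) (X k) ≤ ∑ k : Fin n, (1 : ℝ) :=
          Finset.sum_le_sum fun k _ => indicator_le_self' (s := S) (f := (1 : ℝ → ℝ)) (by simp) _
      _ = n := by simp
  exact Real.exp_le_exp.2 (mul_le_mul (le_abs_self l) h1 h0 (abs_nonneg l))

/-- A Bernstein-type tail bound for the empirical measure of a set of small mass. -/
lemma measureReal_le_abs_empDev (ν : Measure ℝ) [IsProbabilityMeasure ν] {n : ℕ} (hn : 0 < n)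
    {S : Set ℝ} (hS : MeasurableSet S) {l p : ℝ} (hl0 : 0 ≤ l) (hl1 : l ≤ 1)
    (hp : ν.real S ≤ p) (u : ℝ) :
    (Measure.pi fun _ : Fin n => ν).real {X | u ≤ |empDev ν X S|} ≤
      2 * Real.exp (n * (l ^ 2 * p - l * u)) := by
  have hn' : (0 : ℝ) < n := by exact_mod_cast hn
  set Z : (Fin n → ℝ) → ℝ := fun X => ∑ k, S.indicator (1 : ℝ → ℝ) (X k)
  have hsub : {X : Fin n → ℝ | u ≤ |empDev ν X S|} ⊆
      {X | n * (ν.real S + u) ≤ Z X} ∪ {X | Z X ≤ n * (ν.real S - u)} := by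
    intro X hX
    rcases le_abs.1 (show u ≤ |empDev ν X S| from hX) with h | h
    · left
      have : ν.real S + u ≤ Z X / n := by unfold empDev at h; linarith
      simpa [mul_comm] using (le_div_iff₀ hn').1 this
    · right
      have : Z X / n ≤ ν.real S - u := by unfold empDev at h; linarith
      simpa [mul_comm] using (div_le_iff₀ hn').1 this
  have hup := ProbabilityTheory.measure_ge_le_exp_mul_mgf (μ := Measure.pi fun _ : Fin n => ν)
    (X := Z) (n * (ν.real S + u)) hl0 (integrable_exp_mul_sum_indicator ν n hS l)
  have hlo := ProbabilityTheory.measure_le_le_exp_mul_mgf (μ := Measure.pi fun _ : Fin n => ν)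
    (X := Z) (n * (ν.real S - u)) (t := -l) (by linarith)
    (integrable_exp_mul_sum_indicator ν n hS (-l))
  have hup' := hup.trans (mul_le_mul_of_nonneg_left
    (mgf_sum_indicator_le ν n hS (by rwa [abs_of_nonneg hl0])) (Real.exp_pos _).le)
  have hlo' := hlo.trans (mul_le_mul_of_nonneg_left
    (mgf_sum_indicator_le ν n hS (l := -l) (by rwa [abs_neg, abs_of_nonneg hl0]))
    (Real.exp_pos _).le)
  rw [← Real.exp_add] at hup' hlo'
  have hq : l ^ 2 * ν.real S ≤ l ^ 2 * p := by gcongr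
  have hmain : ∀ y : ℝ, y ≤ n * (l ^ 2 * ν.real S - l * u) →
      Real.exp y ≤ Real.exp (n * (l ^ 2 * p - l * u)) := fun y hy => by
    refine Real.exp_le_exp.2 (hy.trans ?_)
    gcongr
  have h1 := hup'.trans (hmain _ (by apply le_of_eq; ring))
  have h2 := hlo'.trans (hmain _ (by apply le_of_eq; ring))
  calc _ ≤ _ := measureReal_mono hsub
    _ ≤ _ := measureReal_union_le _ _
    _ ≤ _ := by linarith

lemma empDev_diff (ν : Measure ℝ) [IsFiniteMeasure ν] {n : ℕ} (X : Fin n → ℝ) {A B : Set ℝ}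
    (hB : MeasurableSet B) (h : B ⊆ A) :
    empDev ν X (A \ B) = empDev ν X A - empDev ν X B := by
  unfold empDev
  rw [measureReal_sdiff h hB]
  simp_rw [indicator_sdiff h, Pi.sub_apply, Finset.sum_sub_distrib]
  ring

lemma abs_empDev_le_of_subset (ν : Measure ℝ) [IsFiniteMeasure ν] {n : ℕ} (X : Fin n → ℝ)
    {A B : Set ℝ} (h : A ⊆ B) : |empDev ν X A| ≤ |empDev ν X B| + ν.real B := by
  have hν : ν.real A ≤ ν.real B := measureReal_mono h
  have hν0 : 0 ≤ ν.real A := measureReal_nonneg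
  have h0 : 0 ≤ (∑ k, A.indicator (1 : ℝ → ℝ) (X k)) / n :=
    div_nonneg (Finset.sum_nonneg fun k _ => indicator_nonneg (by simp) _) (by positivity)
  have h1 : (∑ k, A.indicator (1 : ℝ → ℝ) (X k)) / n ≤
      (∑ k, B.indicator (1 : ℝ → ℝ) (X k)) / n := by
    gcongr with k
    exact zero_le_one' ℝ
  have h2 := le_abs_self (empDev ν X B)
  have h3 := abs_nonneg (empDev ν X B)
  rw [abs_le]
  unfold empDev at *
  constructor <;> linarith

/-- An order-connected set is no heavier than the heaviest of the closed intervals it contains. -/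
lemma measureReal_le_of_ordConnected (μ : Measure ℝ) [IsFiniteMeasure μ] {S : Set ℝ}
    (hS : S.OrdConnected) {β : ℝ} (hβ : 0 ≤ β)
    (h : ∀ x ∈ S, ∀ y ∈ S, x ≤ y → μ.real (Icc x y) ≤ β) : μ.real S ≤ β := by
  refine ENNReal.toReal_le_of_le_ofReal hβ ?_
  rw [hS.measurableSet.measure_eq_iSup_isCompact]
  refine iSup₂_le fun K hK => iSup_le fun hKc => ?_
  rcases K.eq_empty_or_nonempty with rfl | hne
  · simp
  have hi := hKc.sInf_mem hne
  have hs := hKc.sSup_mem hne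
  have hle : sInf K ≤ sSup K := csInf_le_csSup hne hKc.bddBelow hKc.bddAbove
  calc μ K ≤ μ (Icc (sInf K) (sSup K)) :=
        measure_mono (subset_Icc_csInf_csSup hKc.bddBelow hKc.bddAbove)
    _ = ENNReal.ofReal (μ.real (Icc (sInf K) (sSup K))) := by simp
    _ ≤ _ := ENNReal.ofReal_le_ofReal (h _ (hK hi) _ (hK hs) hle)

/-- `U` can change only at the points of `C`. -/
def CutBy (C : Finset ℝ) (U : Set ℝ) : Prop :=
  ∀ x y, x < y → (∀ c ∈ C, x ≤ c → y ≤ c) → (x ∈ U ↔ y ∈ U)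

lemma CutBy.exists_cut {C : Finset ℝ} {U : Set ℝ} (hU : CutBy C U) {idx : ℝ → ℕ}
    (hidx : Monotone idx) {x y : ℝ} (hxy : idx x = idx y) (hx : x ∉ U) (hy : y ∈ U) :
    ∃ c ∈ C, idx c = idx x := by
  by_contra! hno
  rcases lt_trichotomy x y with h | h | h
  · refine hx ((hU x y h fun c hc hxc => ?_).2 hy)
    by_contra! hcy
    exact hno c hc (le_antisymm ((hidx hcy.le).trans hxy.ge) (hidx hxc))
  · exact hx (h ▸ hy)
  · refine hx ((hU y x h fun c hc hyc => ?_).1 hy)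
    by_contra! hcx
    exact hno c hc (le_antisymm (hidx hcx.le) (hxy.le.trans (hidx hyc)))

/-- Chaining along a nested sequence of monotone cell indices: if the empirical measure is
accurate on all unions of at most `2 * M` cells at every level, then it is accurate on every set
with at most `M` cut points. -/
lemma abs_empDev_le_of_levels (ν : Measure ℝ) [IsFiniteMeasure ν] {n : ℕ} (X : Fin n → ℝ)
    {M J : ℕ} (hM : 0 < M) {idx : ℕ → ℝ → ℕ} (hmono : ∀ j, Monotone (idx j))
    (hnest : ∀ j x, idx j x = (idx (j + 1) x + 1) / 2)
    (hrange : ∀ j x, idx j x < 2 ^ j * M + 1)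
    (hmass : ∀ i, ν.real (idx J ⁻¹' {i}) ≤ 1 / (2 ^ J * M))
    {u : ℕ → ℝ}
    (hgood : ∀ j ≤ J, ∀ T ⊆ Finset.range (2 ^ j * M + 1), T.card ≤ 2 * M →
      |empDev ν X (idx j ⁻¹' T)| ≤ u j)
    {U : Set ℝ} (hUm : MeasurableSet U) {C : Finset ℝ} (hC : C.card ≤ M) (hU : CutBy C U) :
    |empDev ν X U| ≤ ∑ j ∈ Finset.range (J + 1), u j + u J + 1 / 2 ^ J := by
  classical
  have hsat : ∀ j ≤ J, ∀ A : Set ℝ, (∀ x y, idx j x = idx j y → x ∈ A → y ∈ A) →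
      ∀ R : Finset ℕ, R.card ≤ 2 * M → (∀ x ∈ A, idx j x ∈ R) → |empDev ν X A| ≤ u j := by
    intro j hj A hA R hR hAR
    have hAeq : A = idx j ⁻¹'
        ((R.filter fun i => ∃ x ∈ A, idx j x = i : Finset ℕ) : Set ℕ) := by
      ext x
      simp only [mem_preimage, Finset.coe_filter, mem_ofPred_eq]
      exact ⟨fun hx => ⟨hAR x hx, x, hx, rfl⟩, fun ⟨_, y, hy, hyx⟩ => hA y x hyx hy⟩
    rw [hAeq]
    refine hgood j hj _ (fun i hi => ?_) ((Finset.card_filter_le _ _).trans hR)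
    obtain ⟨_, x, _, rfl⟩ := Finset.mem_filter.1 hi
    exact Finset.mem_range.2 (hrange j x)
  set V : ℕ → Set ℝ := fun j => idx j ⁻¹' (idx j '' U) with hV
  have hVm : ∀ j, MeasurableSet (V j) := fun j =>
    (hmono j).measurable (MeasurableSet.of_discrete)
  have hUV : ∀ j, U ⊆ V j := fun j => subset_preimage_image _ _
  have hanti : ∀ j, V (j + 1) ⊆ V j := by
    rintro j x ⟨y, hy, hyx⟩
    exact ⟨y, hy, by rw [hnest, hnest j x, hyx]⟩
  have hcut : ∀ j x, x ∈ V j → x ∉ U → idx j x ∈ C.image (idx j) := by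
    rintro j x ⟨y, hy, hyx⟩ hx
    obtain ⟨c, hc, hcx⟩ := hU.exists_cut (hmono j) hyx.symm hx hy
    exact Finset.mem_image.2 ⟨c, hc, hcx⟩
  have hVdev : ∀ j ≤ J, |empDev ν X (V j)| ≤ ∑ i ∈ Finset.range (j + 1), u i := by
    intro j
    induction j with
    | zero =>
      intro h0
      rw [zero_add, Finset.sum_range_one]
      refine hsat 0 h0 _ (fun x y hxy hx => ?_) (Finset.range (M + 1)) (by simp; omega)
        fun x _ => ?_
      · simpa only [hV, mem_preimage, ← hxy] using hx
      · simpa using hrange 0 x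
    | succ j ih =>
      intro hj
      have hd : |empDev ν X (V j \ V (j + 1))| ≤ u (j + 1) := by
        refine hsat (j + 1) hj _ (fun x y hxy hx => ?_)
          ((C.image (idx j)).biUnion fun p => {2 * p - 1, 2 * p}) ?_ fun x hx => ?_
        · have hxy' : idx j x = idx j y := by rw [hnest, hnest j y, hxy]
          simpa only [hV, mem_sdiff, mem_preimage, ← hxy, ← hxy'] using hx
        · calc _ ≤ (C.image (idx j)).card * 2 :=
                Finset.card_biUnion_le_card_mul _ _ _ fun p _ => Finset.card_le_two
            _ ≤ 2 * M := by
                have := Finset.card_image_le (s := C) (f := idx j)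
                omega
        · have h1 := hcut j x hx.1 fun h => hx.2 (hUV _ h)
          refine Finset.mem_biUnion.2 ⟨_, h1, ?_⟩
          have := hnest j x
          simp only [Finset.mem_insert, Finset.mem_singleton]
          omega
      rw [empDev_diff ν X (hVm _) (hanti j)] at hd
      rw [Finset.sum_range_succ]
      have h1 := abs_le.1 hd
      have h2 := abs_le.1 (ih (by omega))
      rw [abs_le]
      constructor <;> linarith
  set B : Set ℝ := idx J ⁻¹' (C.image (idx J) : Finset ℕ) with hB
  have hBdev : |empDev ν X B| ≤ u J := by
    refine hsat J le_rfl B (fun x y hxy hx => ?_) (C.image (idx J)) ?_ fun x hx => hx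
    · simpa only [hB, mem_preimage, ← hxy] using hx
    · have := Finset.card_image_le (s := C) (f := idx J)
      omega
  have hBmass : ν.real B ≤ 1 / 2 ^ J := by
    have hBeq : B = ⋃ i ∈ C.image (idx J), idx J ⁻¹' {i} := by
      ext x
      simp [hB, eq_comm]
    rw [hBeq]
    calc _ ≤ ∑ i ∈ C.image (idx J), ν.real (idx J ⁻¹' {i}) := measureReal_biUnion_finset_le _ _
      _ ≤ ∑ i ∈ C.image (idx J), 1 / (2 ^ J * (M : ℝ)) := Finset.sum_le_sum fun i _ => hmass i
      _ = (C.image (idx J)).card * (1 / (2 ^ J * (M : ℝ))) := by simp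
      _ ≤ M * (1 / (2 ^ J * (M : ℝ))) := by
          gcongr
          exact Finset.card_image_le.trans hC
      _ = 1 / 2 ^ J := by
          have : (M : ℝ) ≠ 0 := by positivity
          field_simp
  have hres := abs_empDev_le_of_subset ν X (A := V J \ U) (B := B)
    fun x hx => hcut J x hx.1 hx.2
  rw [empDev_diff ν X hUm (hUV J)] at hres
  have h1 := abs_le.1 (hres.trans (add_le_add hBdev hBmass))
  have h2 := abs_le.1 (hVdev J le_rfl)
  rw [abs_le]
  constructor <;> linarith

lemma natCeil_eq_half_natCeil_two_mul (y : ℝ) : ⌈y⌉₊ = (⌈2 * y⌉₊ + 1) / 2 := by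
  apply le_antisymm
  · rw [Nat.ceil_le]
    have h1 : 2 * y ≤ ⌈2 * y⌉₊ := Nat.le_ceil _
    have h2 : ((⌈2 * y⌉₊ : ℕ) : ℝ) ≤ 2 * (((⌈2 * y⌉₊ + 1) / 2 : ℕ) : ℝ) := by
      norm_cast
      omega
    linarith
  · have : ⌈2 * y⌉₊ ≤ 2 * ⌈y⌉₊ := by
      rw [Nat.ceil_le]
      push_cast
      linarith [Nat.le_ceil y]
    omega

/-- The index of the cell containing `x` when the line is divided into `N` cells of equal
`ν`-mass, together with a null cell of index `0`. -/
noncomputable def quantileCell (ν : Measure ℝ) (N : ℝ) (x : ℝ) : ℕ := ⌈N * ν.real (Iic x)⌉₊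

lemma monotone_quantileCell (ν : Measure ℝ) [IsFiniteMeasure ν] {N : ℝ} (hN : 0 ≤ N) :
    Monotone (quantileCell ν N) := fun x y hxy =>
  Nat.ceil_mono (mul_le_mul_of_nonneg_left (measureReal_mono (Iic_subset_Iic.2 hxy)) hN)

lemma measureReal_Icc_eq (ν : Measure ℝ) [IsFiniteMeasure ν] [NullSingletonClass ν] {x y : ℝ}
    (hxy : x ≤ y) : ν.real (Icc x y) = ν.real (Iic y) - ν.real (Iic x) := by
  rw [← measureReal_congr (Ioc_ae_eq_Icc (μ := ν) (a := x) (b := y)), ← Iic_sdiff_Iic,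
    measureReal_sdiff (Iic_subset_Iic.2 hxy) measurableSet_Iic]

lemma measureReal_quantileCell_le (ν : Measure ℝ) [IsFiniteMeasure ν] [NullSingletonClass ν]
    {N : ℝ} (hN : 0 < N) (i : ℕ) : ν.real (quantileCell ν N ⁻¹' {i}) ≤ 1 / N := by
  refine measureReal_le_of_ordConnected ν (ordConnected_singleton.preimage_mono
    (monotone_quantileCell ν hN.le)) (by positivity) fun x hx y hy hxy => ?_
  rw [measureReal_Icc_eq ν hxy, le_div_iff₀ hN]
  have hx' : ⌈N * ν.real (Iic x)⌉₊ = i := hx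
  have hy' : ⌈N * ν.real (Iic y)⌉₊ = i := hy
  have h1 : N * ν.real (Iic y) ≤ i := hy' ▸ Nat.le_ceil _
  have h2 : (i : ℝ) < N * ν.real (Iic x) + 1 := hx' ▸ Nat.ceil_lt_add_one (by positivity)
  linarith

lemma card_filter_powerset_le (s : Finset ℕ) (K : ℕ) {x : ℝ} (hx0 : 0 < x) (hx1 : x ≤ 1) :
    ((s.powerset.filter fun T => T.card ≤ K).card : ℝ) * x ^ K ≤ Real.exp (x * s.card) := by
  calc ((s.powerset.filter fun T => T.card ≤ K).card : ℝ) * x ^ K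
      = ∑ T ∈ s.powerset.filter (fun T => T.card ≤ K), x ^ K := by simp
    _ ≤ ∑ T ∈ s.powerset.filter (fun T => T.card ≤ K), x ^ T.card :=
        Finset.sum_le_sum fun T hT =>
          pow_le_pow_of_le_one hx0.le hx1 (Finset.mem_filter.1 hT).2
    _ ≤ ∑ T ∈ s.powerset, x ^ T.card :=
        Finset.sum_le_sum_of_subset_of_nonneg (Finset.filter_subset _ _)
          fun _ _ _ => by positivity
    _ = (x + 1) ^ s.card := by simpa using Finset.sum_pow_mul_eq_add_pow x 1 s
    _ ≤ Real.exp x ^ s.card := by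
        gcongr
        exact Real.add_one_le_exp x
    _ = _ := by rw [mul_comm, Real.exp_nat_mul]

lemma card_cell_unions_le {M : ℕ} (hM : 0 < M) (j : ℕ) :
    (((Finset.range (2 ^ j * M + 1)).powerset.filter fun T => T.card ≤ 2 * M).card : ℝ) ≤
      Real.exp (2 * j * M + 2 * M) := by
  have h := card_filter_powerset_le (Finset.range (2 ^ j * M + 1)) (2 * M)
    (x := (1 / 2) ^ j) (by positivity) (pow_le_one₀ (by norm_num) (by norm_num))
  have hM' : (1 : ℝ) ≤ M := by exact_mod_cast hM
  have h2 : ((1 : ℝ) / 2) ^ j * ((Finset.range (2 ^ j * M + 1)).card : ℝ) ≤ 2 * M := by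
    rw [Finset.card_range]
    push_cast
    have h3 : ((1 : ℝ) / 2) ^ j * 2 ^ j = 1 := by rw [← mul_pow]; norm_num
    have h4 : ((1 : ℝ) / 2) ^ j ≤ 1 := pow_le_one₀ (by norm_num) (by norm_num)
    calc ((1 : ℝ) / 2) ^ j * (2 ^ j * M + 1) = (1 / 2) ^ j * 2 ^ j * M + (1 / 2) ^ j := by ring
      _ ≤ 2 * M := by rw [h3]; linarith
  have h5 : (2 : ℝ) ^ (j * (2 * M)) ≤ Real.exp (2 * j * M) := by
    have h2e : (2 : ℝ) ≤ Real.exp 1 := by linarith [Real.add_one_le_exp (1 : ℝ)]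
    calc (2 : ℝ) ^ (j * (2 * M)) ≤ Real.exp 1 ^ (j * (2 * M)) := by gcongr
      _ = Real.exp (2 * j * M) := by
        rw [← Real.exp_nat_mul]
        push_cast
        ring_nf
  have h6 : (((1 : ℝ) / 2) ^ j) ^ (2 * M) * 2 ^ (j * (2 * M)) = 1 := by
    rw [← pow_mul, ← mul_pow]; norm_num
  set c := (((Finset.range (2 ^ j * M + 1)).powerset.filter fun T => T.card ≤ 2 * M).card : ℝ)
  calc c = c * (((1 : ℝ) / 2) ^ j) ^ (2 * M) * 2 ^ (j * (2 * M)) := by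
        rw [mul_assoc, h6, mul_one]
    _ ≤ Real.exp (2 * M) * Real.exp (2 * j * M) := by
        gcongr
        exact h.trans (Real.exp_le_exp.2 h2)
    _ = _ := by rw [← Real.exp_add, add_comm]

lemma sum_geometric_bounds (ρ c : ℝ) (m : ℕ) :
    ∑ j ∈ Finset.range m, (ρ * (3 / 2) ^ j * (2 / 2 ^ j) +
      c * (3 * j + 5) / (ρ * (3 / 2) ^ j)) =
      8 * ρ * (1 - (3 / 4) ^ m) + c / ρ * (33 - (9 * m + 33) * (2 / 3) ^ m) := by
  induction m with
  | zero => simp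
  | succ m ih =>
    rw [Finset.sum_range_succ, ih]
    have h1 : ρ * (3 / 2) ^ m * (2 / 2 ^ m) = 2 * ρ * (3 / 4) ^ m := by
      have : ((3 : ℝ) / 4) ^ m = (3 / 2) ^ m / 2 ^ m := by rw [← div_pow]; norm_num
      rw [this]
      ring
    have h2 : c * (3 * (m : ℝ) + 5) / (ρ * (3 / 2) ^ m) =
        c / ρ * ((3 * m + 5) * (2 / 3) ^ m) := by
      have : ((2 : ℝ) / 3) ^ m = ((3 / 2) ^ m)⁻¹ := by rw [← inv_pow]; norm_num
      rw [this]
      ring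
    rw [h1, h2]
    push_cast
    ring

/-- The tolerance at level `j` of the chaining argument. -/
noncomputable def chainTol (M n : ℕ) (ρ : ℝ) (j : ℕ) : ℝ :=
  ρ * (3 / 2) ^ j * (2 / 2 ^ j) + (M / n : ℝ) * (3 * j + 5) / (ρ * (3 / 2) ^ j)

lemma chainTol_nonneg (M n : ℕ) {ρ : ℝ} (hρ : 0 ≤ ρ) (j : ℕ) : 0 ≤ chainTol M n ρ j := by
  unfold chainTol
  positivity

lemma measureReal_level_failure_le (ν : Measure ℝ) [IsProbabilityMeasure ν] {n : ℕ} (hn : 0 < n)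
    {M : ℕ} (hM : 0 < M) {idx : ℝ → ℕ} (hidx : Measurable idx) (j : ℕ)
    (hmass : ∀ i, ν.real (idx ⁻¹' {i}) ≤ 1 / (2 ^ j * M)) {ρ : ℝ} (hρ : 0 < ρ)
    (hl : ρ * (3 / 2) ^ j ≤ 1) :
    (Measure.pi fun _ : Fin n => ν).real
      (⋃ T ∈ (Finset.range (2 ^ j * M + 1)).powerset.filter (fun T => T.card ≤ 2 * M),
        {X | chainTol M n ρ j ≤ |empDev ν X (idx ⁻¹' (T : Set ℕ))|}) ≤
      Real.exp (-M) * (1 / 2) ^ (j + 1) := by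
  have hn' : (0 : ℝ) < n := by exact_mod_cast hn
  have hM' : (1 : ℝ) ≤ M := by exact_mod_cast hM
  set F := (Finset.range (2 ^ j * M + 1)).powerset.filter fun T => T.card ≤ 2 * M with hF
  set l := ρ * (3 / 2 : ℝ) ^ j with hl'
  have hl0 : 0 < l := by positivity
  have hT : ∀ T ∈ F, (Measure.pi fun _ : Fin n => ν).real
      {X | chainTol M n ρ j ≤ |empDev ν X (idx ⁻¹' (T : Set ℕ))|} ≤
      2 * Real.exp (-(M * (3 * j + 5))) := by
    intro T hT
    have hm : ν.real (idx ⁻¹' (T : Set ℕ)) ≤ 2 / 2 ^ j := by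
      have hTeq : idx ⁻¹' (T : Set ℕ) = ⋃ i ∈ T, idx ⁻¹' {i} := by ext x; simp
      rw [hTeq]
      calc _ ≤ ∑ i ∈ T, ν.real (idx ⁻¹' {i}) := measureReal_biUnion_finset_le _ _
        _ ≤ ∑ i ∈ T, 1 / (2 ^ j * (M : ℝ)) := Finset.sum_le_sum fun i _ => hmass i
        _ = T.card * (1 / (2 ^ j * (M : ℝ))) := by simp
        _ ≤ (2 * M : ℕ) * (1 / (2 ^ j * (M : ℝ))) := by
            gcongr
            exact (Finset.mem_filter.1 hT).2
        _ = 2 / 2 ^ j := by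
            push_cast
            field_simp
    refine (measureReal_le_abs_empDev ν hn (hidx MeasurableSet.of_discrete) hl0.le hl hm
      _).trans (le_of_eq ?_)
    congr 2
    unfold chainTol
    rw [← hl']
    field_simp
    ring
  have he : Real.exp (-1) ≤ 1 / 2 := by
    rw [Real.exp_neg, ← one_div]
    exact one_div_le_one_div_of_le two_pos (by linarith [Real.add_one_le_exp (1 : ℝ)])
  calc _ ≤ ∑ T ∈ F, (Measure.pi fun _ : Fin n => ν).real
        {X | chainTol M n ρ j ≤ |empDev ν X (idx ⁻¹' (T : Set ℕ))|} :=
        measureReal_biUnion_finset_le _ _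
    _ ≤ ∑ T ∈ F, 2 * Real.exp (-(M * (3 * j + 5))) := Finset.sum_le_sum hT
    _ = F.card * (2 * Real.exp (-(M * (3 * j + 5)))) := by simp
    _ ≤ Real.exp (2 * j * M + 2 * M) * (2 * Real.exp (-(M * (3 * j + 5)))) := by
        gcongr
        exact card_cell_unions_le hM j
    _ = 2 * Real.exp (-(M * (j + 3))) := by
        rw [mul_left_comm, ← Real.exp_add]
        ring_nf
    _ ≤ 2 * Real.exp (-M + ((j + 2 : ℕ) : ℝ) * (-1)) := by
        gcongr
        push_cast
        nlinarith [(Nat.cast_nonneg j : (0 : ℝ) ≤ j)]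
    _ = 2 * (Real.exp (-M) * Real.exp (-1) ^ (j + 2)) := by rw [Real.exp_add, Real.exp_nat_mul]
    _ ≤ 2 * (Real.exp (-M) * (1 / 2) ^ (j + 2)) := by gcongr
    _ = _ := by ring

/-- Uniform convergence of empirical measures over the sets with at most `M` cut points, at the
optimal sample size `O(M / ε²)`. -/
theorem exists_uniform_deviation_event (ν : Measure ℝ) [IsProbabilityMeasure ν]
    [NullSingletonClass ν] {M n : ℕ} (hM : 0 < M) {ε : ℝ} (hε0 : 0 < ε) (hε1 : ε ≤ 1)
    (hn : 16896 * M / ε ^ 2 ≤ n) :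
    ∃ G : Set (Fin n → ℝ), MeasurableSet G ∧
      (Measure.pi fun _ : Fin n => ν).real Gᶜ ≤ Real.exp (-M) ∧
      ∀ X ∈ G, ∀ (U : Set ℝ) (C : Finset ℝ), MeasurableSet U → C.card ≤ M → CutBy C U →
        |empDev ν X U| ≤ ε := by
  have hM' : (0 : ℝ) < M := by exact_mod_cast hM
  have hn' : (0 : ℝ) < n := lt_of_lt_of_le (by positivity) hn
  have hn0 : 0 < n := by exact_mod_cast hn'
  set ρ := ε / 64 with hρ
  have hρ0 : 0 < ρ := by positivity
  obtain ⟨J, hJε, hJ4⟩ : ∃ J : ℕ, 1 / (2 : ℝ) ^ J ≤ ε / 2 ∧ (2 : ℝ) ^ J ≤ 4 / ε := by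
    have hex : ∃ J : ℕ, 1 / (2 : ℝ) ^ J ≤ ε / 2 := by
      obtain ⟨J, hJ⟩ := exists_pow_lt_of_lt_one (half_pos hε0) (by norm_num : (1 / 2 : ℝ) < 1)
      exact ⟨J, by simpa using hJ.le⟩
    classical
    refine ⟨Nat.find hex, Nat.find_spec hex, ?_⟩
    rcases Nat.eq_zero_or_eq_succ_pred (Nat.find hex) with h0 | hs
    · rw [h0, pow_zero, le_div_iff₀ hε0]
      linarith
    · have hlt := Nat.find_min hex (m := (Nat.find hex).pred) (by omega)
      rw [hs, Nat.succ_eq_add_one, pow_succ, le_div_iff₀ hε0]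
      rw [not_le, lt_div_iff₀ (by positivity)] at hlt
      linarith
  set idx : ℕ → ℝ → ℕ := fun j => quantileCell ν (2 ^ j * M) with hidx
  have hmono : ∀ j, Monotone (idx j) := fun j => monotone_quantileCell ν (by positivity)
  have hmass : ∀ j i, ν.real (idx j ⁻¹' {i}) ≤ 1 / (2 ^ j * M) := fun j i =>
    measureReal_quantileCell_le ν (by positivity) i
  have hnest : ∀ j x, idx j x = (idx (j + 1) x + 1) / 2 := by
    intro j x
    simp only [hidx, quantileCell]
    rw [natCeil_eq_half_natCeil_two_mul]
    ring_nf
  have hrange : ∀ j x, idx j x < 2 ^ j * M + 1 := by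
    intro j x
    simp only [hidx, quantileCell]
    rw [Nat.lt_succ_iff, Nat.ceil_le]
    push_cast
    exact mul_le_of_le_one_right (by positivity) measureReal_le_one
  set Bad : ℕ → Set (Fin n → ℝ) := fun j =>
    ⋃ T ∈ (Finset.range (2 ^ j * M + 1)).powerset.filter (fun T => T.card ≤ 2 * M),
      {X | chainTol M n ρ j ≤ |empDev ν X (idx j ⁻¹' (T : Set ℕ))|} with hBad
  have hBadm : ∀ j, MeasurableSet (Bad j) := fun j =>
    Finset.measurableSet_biUnion _ fun T _ => measurableSet_le measurable_const
      (measurable_empDev ν ((hmono j).measurable MeasurableSet.of_discrete)).abs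
  refine ⟨(⋃ j ∈ Finset.range (J + 1), Bad j)ᶜ,
    (Finset.measurableSet_biUnion _ fun j _ => hBadm j).compl, ?_, ?_⟩
  · rw [compl_compl]
    calc _ ≤ ∑ j ∈ Finset.range (J + 1), (Measure.pi fun _ : Fin n => ν).real (Bad j) :=
          measureReal_biUnion_finset_le _ _
      _ ≤ ∑ j ∈ Finset.range (J + 1), Real.exp (-M) * (1 / 2) ^ (j + 1) := by
          refine Finset.sum_le_sum fun j hj => ?_
          refine measureReal_level_failure_le ν hn0 hM (hmono j).measurable j (hmass j) hρ0 ?_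
          have hjJ : j ≤ J := by
            have := Finset.mem_range.1 hj
            omega
          calc ρ * (3 / 2) ^ j ≤ ρ * 2 ^ J := by
                gcongr
                exact (pow_le_pow_left₀ (by norm_num) (by norm_num) j).trans
                  (pow_le_pow_right₀ (by norm_num) hjJ)
            _ ≤ ρ * (4 / ε) := by gcongr
            _ ≤ 1 := by rw [hρ]; field_simp; norm_num
      _ = Real.exp (-M) * ((1 / 2) * ∑ j ∈ Finset.range (J + 1), (1 / 2) ^ j) := by
          simp_rw [Finset.mul_sum, pow_succ']
      _ ≤ Real.exp (-M) * ((1 / 2) * 2) := by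
          gcongr
          rw [geom_sum_eq (by norm_num)]
          have : (0 : ℝ) ≤ (1 / 2) ^ (J + 1) := by positivity
          rw [div_le_iff_of_neg (by norm_num)]
          linarith
      _ = _ := by ring
  · intro X hX U C hU hC hCU
    simp only [hBad, mem_compl_iff, mem_iUnion, not_exists, mem_ofPred_eq, not_le,
      Finset.mem_range, Finset.mem_filter, Finset.mem_powerset, and_imp] at hX
    have h := abs_empDev_le_of_levels ν X hM (J := J) hmono hnest hrange (hmass J)
      (u := chainTol M n ρ)
      (fun j hj T hT hTc => (hX j (by omega) T hT hTc).le) hU hC hCU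
    have hs := sum_geometric_bounds ρ (M / n) (J + 1)
    have hs' : ∑ j ∈ Finset.range (J + 1), chainTol M n ρ j ≤ 8 * ρ + 33 * (M / n / ρ) := by
      unfold chainTol
      rw [hs]
      have h1 : 0 ≤ 8 * ρ * (3 / 4) ^ (J + 1) := by positivity
      have h2 : 0 ≤ (M : ℝ) / n / ρ * ((9 * ((J + 1 : ℕ) : ℝ) + 33) * (2 / 3) ^ (J + 1)) := by
        positivity
      linarith
    have hJle : chainTol M n ρ J ≤ ∑ j ∈ Finset.range (J + 1), chainTol M n ρ j :=
      Finset.single_le_sum (fun j _ => chainTol_nonneg M n hρ0.le j) (by simp)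
    have hMn : 66 * ((M : ℝ) / n / ρ) ≤ ε / 4 := by
      rw [div_le_iff₀ (by positivity)] at hn
      rw [hρ]
      field_simp
      linarith
    have : ρ = ε / 64 := hρ
    linarith

/-- The number of points of the family `c` lying strictly to the left of `x`. -/
noncomputable def cutIndex {ι : Type*} [Fintype ι] (c : ι → ℝ) (x : ℝ) : ℕ :=
  (Finset.univ.filter fun i => c i < x).card

section cutIndex

variable {ι κ : Type*} [Fintype ι] [Fintype κ]

lemma monotone_cutIndex (c : ι → ℝ) : Monotone (cutIndex c) := fun _ _ hxy =>
  Finset.card_le_card (Finset.monotone_filter_right _ fun _ _ h => lt_of_lt_of_le h hxy)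

lemma measurable_cutIndex (c : ι → ℝ) : Measurable (cutIndex c) :=
  (monotone_cutIndex c).measurable

lemma cutIndex_lt (c : ι → ℝ) (x : ℝ) : cutIndex c x < Fintype.card ι + 1 :=
  Nat.lt_succ_of_le (Finset.card_filter_le _ _)

lemma cutIndex_eq_iff (c : ι → ℝ) {x y : ℝ} (hxy : x ≤ y) :
    cutIndex c x = cutIndex c y ↔ ∀ i, x ≤ c i → y ≤ c i := by
  have hsub : (Finset.univ.filter fun i => c i < x) ⊆ Finset.univ.filter fun i => c i < y :=
    Finset.monotone_filter_right _ fun _ _ h => lt_of_lt_of_le h hxy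
  constructor
  · intro h i hi
    by_contra! hlt
    have := Finset.eq_of_subset_of_card_le hsub h.ge
    have hmem : i ∈ Finset.univ.filter fun i => c i < x := this ▸ by simpa using hlt
    exact absurd hi (not_le.2 (Finset.mem_filter.1 hmem).2)
  · intro h
    refine le_antisymm (monotone_cutIndex c hxy) (Finset.card_le_card fun i hi => ?_)
    simp only [Finset.mem_filter, Finset.mem_univ, true_and] at hi ⊢
    by_contra! hlt
    exact absurd (h i hlt) (not_le.2 hi)

lemma cutIndex_sum (c : ι ⊕ κ → ℝ) (x : ℝ) :
    cutIndex c x = cutIndex (fun i => c (Sum.inl i)) x + cutIndex (fun i => c (Sum.inr i)) x := by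
  simp only [cutIndex, Finset.card_filter, Fintype.sum_sum_type]

lemma cutIndex_sum_eq_iff (c : ι ⊕ κ → ℝ) {x y : ℝ} :
    cutIndex c x = cutIndex c y ↔
      cutIndex (fun i => c (Sum.inl i)) x = cutIndex (fun i => c (Sum.inl i)) y ∧
      cutIndex (fun i => c (Sum.inr i)) x = cutIndex (fun i => c (Sum.inr i)) y := by
  rw [cutIndex_sum, cutIndex_sum]
  constructor
  · intro h
    rcases le_total x y with hxy | hxy
    · have h1 := monotone_cutIndex (fun i => c (Sum.inl i)) hxy
      have h2 := monotone_cutIndex (fun i => c (Sum.inr i)) hxy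
      omega
    · have h1 := monotone_cutIndex (fun i => c (Sum.inl i)) hxy
      have h2 := monotone_cutIndex (fun i => c (Sum.inr i)) hxy
      omega
  · rintro ⟨h1, h2⟩
    rw [h1, h2]

lemma cutBy_preimage_cutIndex [DecidableEq ℝ] (c : ι → ℝ) (T : Set ℕ) :
    CutBy (Finset.univ.image c) (cutIndex c ⁻¹' T) := by
  intro x y hxy h
  have : cutIndex c x = cutIndex c y :=
    (cutIndex_eq_iff c hxy.le).2 fun i => h _ (Finset.mem_image_of_mem c (Finset.mem_univ i))
  simp only [mem_preimage, this]

lemma isHistogram_comp_cutIndex {I : Set ℝ} (hI : I.OrdConnected) (c : ι → ℝ) (v : ℕ → ℝ) :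
    IsHistogram I (Fintype.card ι + 1) fun x => v (cutIndex c x) := by
  refine ⟨fun j => I ∩ cutIndex c ⁻¹' {(j : ℕ)}, fun j =>
    hI.inter (ordConnected_singleton.preimage_mono (monotone_cutIndex c)), ?_, ?_, ?_⟩
  · intro i j hij
    rw [Set.disjoint_left]
    rintro x ⟨_, hi⟩ ⟨_, hj⟩
    exact hij (Fin.ext (hi.symm.trans hj))
  · ext x
    simp only [mem_iUnion, mem_inter_iff, exists_and_left, and_iff_left_iff_imp]
    exact fun _ => ⟨⟨_, cutIndex_lt c x⟩, rfl⟩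
  · exact fun j => ⟨v j, fun x hx => congrArg v (show cutIndex c x = j from hx.2)⟩

lemma abs_comp_cutIndex_le (c : ι → ℝ) (w : ℕ → ℝ) (x : ℝ) :
    |w (cutIndex c x)| ≤ ∑ j ∈ Finset.range (Fintype.card ι + 1), |w j| :=
  Finset.single_le_sum (f := fun j => |w j|) (fun j _ => abs_nonneg (w j))
    (Finset.mem_range.2 (cutIndex_lt c x))

lemma measurable_comp_cutIndex (c : ι → ℝ) (w : ℕ → ℝ) :
    Measurable fun x => w (cutIndex c x) :=
  Measurable.of_discrete.comp (measurable_cutIndex c)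

lemma integrable_comp_cutIndex (μ : Measure ℝ) [IsFiniteMeasure μ] (c : ι → ℝ) (w : ℕ → ℝ) :
    Integrable (fun x => w (cutIndex c x)) μ :=
  Integrable.of_bound (measurable_comp_cutIndex c w).aestronglyMeasurable _
    (ae_of_all _ fun x => abs_comp_cutIndex_le c w x)

end cutIndex

lemma IsHistogram.exists_eq_comp_cutIndex {a b : ℝ} {t : ℕ} {g : ℝ → ℝ}
    (hg : IsHistogram (Icc a b) t g) :
    ∃ (d : Fin t → ℝ) (w : ℕ → ℝ), ∀ x ∈ Icc a b, x ∉ range d → g x = w (cutIndex d x) := by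
  obtain ⟨P, hP, -, hU, hc⟩ := hg
  have hbdd : ∀ i, BddAbove (P i) := fun i =>
    bddAbove_Icc.mono (hU ▸ subset_iUnion P i)
  set d : Fin t → ℝ := fun i => sSup (P i) with hd
  have key : ∀ x ∈ Icc a b, ∀ y ∈ Icc a b, y ∉ range d → x ≤ y →
      cutIndex d x = cutIndex d y → g x = g y := by
    intro x hx y hy hyd hxy h
    rw [← hU] at hx
    obtain ⟨i, hi⟩ := mem_iUnion.1 hx
    have hyi : y ≤ d i := (cutIndex_eq_iff d hxy).1 h i (le_csSup (hbdd i) hi)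
    have hlt : y < d i := lt_of_le_of_ne hyi fun h => hyd ⟨i, h.symm⟩
    obtain ⟨z, hz, hyz⟩ := exists_lt_of_lt_csSup ⟨x, hi⟩ hlt
    obtain ⟨cst, hcst⟩ := hc i
    rw [hcst x hi, hcst y ((hP i).out hi hz ⟨hxy, hyz.le⟩)]
  classical
  refine ⟨d, fun j => if h : ∃ x ∈ Icc a b, x ∉ range d ∧ cutIndex d x = j
    then g h.choose else 0, fun x hx hxd => ?_⟩
  have hex : ∃ y ∈ Icc a b, y ∉ range d ∧ cutIndex d y = cutIndex d x := ⟨x, hx, hxd, rfl⟩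
  simp only [dif_pos hex]
  obtain ⟨h1, h2, h3⟩ := hex.choose_spec
  rcases le_total x hex.choose with hle | hle
  · exact key _ hx _ h1 h2 hle h3.symm
  · exact (key _ h1 _ hx hxd hle h3).symm

lemma exists_rat_cutIndex_approx {ι : Type*} [Fintype ι] {μ : Measure ℝ} [IsFiniteMeasure μ]
    {f : ℝ → ℝ} (hf : Integrable f μ) (d : ι → ℝ) (w : ℕ → ℝ) {η : ℝ} (hη : 0 < η) :
    ∃ d' : ι → ℚ, ∫ x, |w (cutIndex (fun i => (d' i : ℝ)) x) - f x| ∂μ <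
      ∫ x, |w (cutIndex d x) - f x| ∂μ + η := by
  have hex : ∀ (n : ℕ) (i : ι), ∃ q : ℚ, d i < q ∧ (q : ℝ) < d i + 1 / ((n : ℝ) + 1) :=
    fun n i => exists_rat_btwn (by linarith [Nat.one_div_pos_of_nat (α := ℝ) (n := n)])
  choose q hq1 hq2 using hex
  have hlim : ∀ x, ∀ᶠ n in Filter.atTop,
      cutIndex (fun i => (q n i : ℝ)) x = cutIndex d x := by
    intro x
    have hi : ∀ i, ∀ᶠ n in Filter.atTop, ((q n i : ℝ) < x ↔ d i < x) := by
      intro i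
      by_cases hx : d i < x
      · have ht : Filter.Tendsto (fun n : ℕ => d i + 1 / ((n : ℝ) + 1)) Filter.atTop
            (nhds (d i + 0)) := tendsto_const_nhds.add tendsto_one_div_add_atTop_nhds_zero_nat
        filter_upwards [ht.eventually_lt_const (by simpa using hx)] with n hn
        exact ⟨fun _ => hx, fun _ => (hq2 n i).trans hn⟩
      · exact Filter.Eventually.of_forall fun n => ⟨fun h => (hq1 n i).trans h, fun h =>
          absurd h hx⟩
    filter_upwards [Filter.eventually_all.2 hi] with n hn
    simp only [cutIndex, hn]
  have htend : Filter.Tendsto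
      (fun n => ∫ x, |w (cutIndex (fun i => (q n i : ℝ)) x) - f x| ∂μ) Filter.atTop
      (nhds (∫ x, |w (cutIndex d x) - f x| ∂μ)) := by
    refine tendsto_integral_of_dominated_convergence
      (fun x => (∑ j ∈ Finset.range (Fintype.card ι + 1), |w j|) + |f x|)
      (fun n => ((integrable_comp_cutIndex μ _ w).sub hf).abs.aestronglyMeasurable)
      ((integrable_const _).add hf.abs) (fun n => ae_of_all _ fun x => ?_)
      (ae_of_all _ fun x => tendsto_const_nhds.congr' ?_)
    · rw [Real.norm_eq_abs, abs_abs]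
      exact (abs_sub _ _).trans (add_le_add_left (abs_comp_cutIndex_le _ w x) _)
    · filter_upwards [hlim x] with n hn
      rw [hn]
  obtain ⟨n, hn⟩ := (htend.eventually_lt_const (lt_add_of_pos_right _ hη)).exists
  exact ⟨q n, hn⟩

/-- Histograms with rational cut points come arbitrarily close to the optimal error. -/
lemma exists_rat_cutIndex_le_OPThist {a b : ℝ} (hab : a < b) {t : ℕ} (ht : 0 < t) {f : ℝ → ℝ}
    (hf : IntegrableOn f (Icc a b)) {η : ℝ} (hη : 0 < η) :
    ∃ (d : Fin t → ℚ) (w : ℕ → ℝ),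
      ∫ x in Icc a b, |w (cutIndex (fun i => (d i : ℝ)) x) - f x| ≤
        OPThist (Icc a b) t f + η := by
  have hne : { y : ℝ | ∃ g : ℝ → ℝ, IsHistogram (Icc a b) t g ∧ IsPDFOn g (Icc a b) ∧
      y = ∫ x in Icc a b, |g x - f x| }.Nonempty := by
    have hba : 0 < b - a := sub_pos.2 hab
    refine ⟨_, fun _ => 1 / (b - a), ?_, ⟨fun x _ => by positivity, integrableOn_const (by simp),
      ?_⟩, rfl⟩
    · refine ⟨fun i => if i = ⟨0, ht⟩ then Icc a b else ∅, fun i => ?_, fun i j hij => ?_, ?_,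
        fun i => ⟨_, fun _ _ => rfl⟩⟩
      · dsimp only
        split_ifs
        · exact ordConnected_Icc
        · exact ordConnected_empty
      · dsimp only
        split_ifs with hi hj
        · exact absurd (hi.trans hj.symm) hij
        all_goals simp
      · refine subset_antisymm (iUnion_subset fun i => ?_) fun x hx =>
          mem_iUnion.2 ⟨⟨0, ht⟩, by simpa using hx⟩
        split_ifs <;> simp
    · simp [hab.le, hba.ne']
  obtain ⟨_, ⟨g, hg, hgpdf, rfl⟩, hlt⟩ := Real.lt_sInf_add_pos hne (half_pos hη)
  obtain ⟨d, w, hdw⟩ := hg.exists_eq_comp_cutIndex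
  obtain ⟨d', hd'⟩ := exists_rat_cutIndex_approx hf d w (half_pos hη)
  refine ⟨d', w, ?_⟩
  have heq : ∫ x in Icc a b, |w (cutIndex d x) - f x| = ∫ x in Icc a b, |g x - f x| := by
    refine integral_congr_ae ?_
    filter_upwards [ae_restrict_mem measurableSet_Icc,
      ae_restrict_of_ae ((finite_range d).countable.ae_notMem volume)] with x hx hxd
    rw [hdw x hx hxd]
  unfold OPThist
  linarith

lemma continuous_measureReal_Iic (ν : Measure ℝ) [IsFiniteMeasure ν] [NullSingletonClass ν] :
    Continuous fun x => ν.real (Iic x) := by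
  have h : (fun x => ν.real (Iic x)) = fun x => ν.real (Iic 0) + ∫ _ in (0 : ℝ)..x, (1 : ℝ) ∂ν := by
    ext x
    rw [← intervalIntegral.integral_Iic_sub_Iic (integrable_const _).integrableOn
      (integrable_const _).integrableOn]
    simp
  rw [h]
  exact continuous_const.add (intervalIntegral.continuous_primitive
    (fun _ _ => (integrable_const (1 : ℝ)).intervalIntegrable) 0)

/-- Every level strictly between `0` and the total mass is nearly attained by the distribution
function at a rational point. -/
lemma exists_rat_abs_measureReal_Iic_sub_lt (ν : Measure ℝ) [IsFiniteMeasure ν]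
    [NullSingletonClass ν] {l η : ℝ} (hl0 : 0 < l) (hl1 : l < ν.real univ) (hη : 0 < η) :
    ∃ q : ℚ, |ν.real (Iic (q : ℝ)) - l| < η := by
  have hcont := continuous_measureReal_Iic ν
  have hbot : Filter.Tendsto (fun x => ν.real (Iic x)) Filter.atBot (nhds 0) := by
    simpa using tendsto_integral_Iic_zero (f := fun _ => (1 : ℝ)) (μ := ν) Filter.tendsto_id
  have htop : Filter.Tendsto (fun x => ν.real (Iic x)) Filter.atTop (nhds (ν.real univ)) :=
    (ENNReal.tendsto_toReal (measure_ne_top ν univ)).comp (tendsto_measure_Iic_atTop ν)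
  obtain ⟨x, hx⟩ := (hbot.eventually_lt_const hl0).exists
  obtain ⟨y, hy⟩ := (htop.eventually_const_lt hl1).exists
  obtain ⟨z, hz⟩ := mem_range_of_exists_le_of_exists_ge hcont ⟨x, hx.le⟩ ⟨y, hy.le⟩
  obtain ⟨q, hq⟩ := Rat.denseRange_cast (𝕜 := ℝ).exists_mem_open
    (isOpen_lt (hcont.sub continuous_const).abs continuous_const)
    ⟨z, show |ν.real (Iic z) - l| < η by simpa [hz] using hη⟩
  exact ⟨q, hq⟩

/-- Finitely many rational points cut the line into intervals of nearly equal mass. -/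
lemma exists_rat_cuts_measureReal_le (ν : Measure ℝ) [IsFiniteMeasure ν] [NullSingletonClass ν]
    (r : ℕ) {η : ℝ} (hη : 0 < η) :
    ∃ q : Fin r → ℚ, ∀ S : Set ℝ, S.OrdConnected →
      (∀ x ∈ S, ∀ y ∈ S, x ≤ y → ∀ i, x ≤ (q i : ℝ) → y ≤ (q i : ℝ)) →
      ν.real S ≤ ν.real univ / (r + 1) + η := by
  rcases (measureReal_nonneg (μ := ν) (s := univ)).eq_or_lt with h0 | hL
  · refine ⟨fun _ => 0, fun S _ _ => ?_⟩
    have := measureReal_mono (μ := ν) (subset_univ S)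
    rw [← h0] at this ⊢
    simpa using this.trans hη.le
  set L := ν.real univ with hLdef
  have hr : (0 : ℝ) < r + 1 := by positivity
  have hex : ∀ i : Fin r, ∃ q : ℚ, |ν.real (Iic (q : ℝ)) - (i + 1) * (L / (r + 1))| < η / 2 := by
    intro i
    refine exists_rat_abs_measureReal_Iic_sub_lt ν (by positivity) ?_ (half_pos hη)
    have hi : ((i : ℕ) : ℝ) + 1 < r + 1 := by exact_mod_cast Nat.succ_lt_succ i.2
    calc ((i : ℕ) + 1 : ℝ) * (L / (r + 1)) < (r + 1) * (L / (r + 1)) := by gcongr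
      _ = L := by field_simp
  choose q hq using hex
  refine ⟨q, fun S hS hcut => measureReal_le_of_ordConnected ν hS (by positivity)
    fun x hx y hy hxy => ?_⟩
  rw [measureReal_Icc_eq ν hxy]
  by_contra! hlt
  set D := L / (r + 1) with hD
  have hDpos : 0 < D := by positivity
  have hx0 : 0 ≤ ν.real (Iic x) := measureReal_nonneg
  have hyL : ν.real (Iic y) ≤ L := measureReal_mono (subset_univ _)
  set k := ⌊(ν.real (Iic x) + η / 2) / D⌋₊ with hk
  have hk1 : k * D ≤ ν.real (Iic x) + η / 2 :=
    (le_div_iff₀ hDpos).1 (Nat.floor_le (by positivity))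
  have hk2 : ν.real (Iic x) + η / 2 < (k + 1) * D :=
    (div_lt_iff₀ hDpos).1 (Nat.lt_floor_add_one _)
  have hLD : L = (r + 1) * D := by rw [hD]; field_simp
  have hkr : k < r := by
    have : ((k : ℝ) + 1) * D < (r + 1) * D := by linarith
    have := lt_of_mul_lt_mul_right this hDpos.le
    exact_mod_cast (add_lt_add_iff_right 1).1 this
  have hqk := abs_lt.1 (hq ⟨k, hkr⟩)
  have hxq : x ≤ (q ⟨k, hkr⟩ : ℝ) := by
    by_contra! hcon
    have := measureReal_mono (μ := ν) (Iic_subset_Iic.2 hcon.le)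
    linarith [hqk.1]
  have := measureReal_mono (μ := ν) (Iic_subset_Iic.2 (hcut x hx y hy hxy _ hxq))
  linarith [hqk.2]

lemma measureReal_withDensity_ofReal {α : Type*} [MeasurableSpace α] {μ : Measure α} {φ : α → ℝ}
    (hφ : Integrable φ μ) (h0 : 0 ≤ᵐ[μ] φ) {S : Set α} (hS : MeasurableSet S) :
    (μ.withDensity fun x => ENNReal.ofReal (φ x)).real S = ∫ x in S, φ x ∂μ := by
  rw [Measure.real, withDensity_apply _ hS,
    integral_eq_lintegral_of_nonneg_ae (ae_restrict_of_ae h0) hφ.aestronglyMeasurable.restrict]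

lemma abs_setIntegral_sub_average_le {μ : Measure ℝ} [IsFiniteMeasure μ] {f : ℝ → ℝ}
    (hf : Integrable f μ) {S : Set ℝ} {v η : ℝ}
    (hv : |v - ⨍ x in S, f x ∂μ| ≤ η) :
    |∫ x in S, (v - f x) ∂μ| ≤ η * μ.real S := by
  have h : ∫ x in S, (v - f x) ∂μ = μ.real S * (v - ⨍ x in S, f x ∂μ) := by
    rw [integral_sub (integrable_const _) hf.integrableOn, mul_sub]
    rw [← smul_eq_mul _ (⨍ x in S, f x ∂μ), measure_smul_setAverage _ (measure_ne_top _ _)]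
    simp
  rw [h, abs_mul, abs_of_nonneg measureReal_nonneg, mul_comm]
  gcongr

lemma setIntegral_abs_sub_average_le {μ : Measure ℝ} [IsFiniteMeasure μ] {f : ℝ → ℝ}
    (hf : Integrable f μ) {S : Set ℝ} {v η : ℝ}
    (hv : |v - ⨍ x in S, f x ∂μ| ≤ η) (w : ℝ) :
    ∫ x in S, |v - f x| ∂μ ≤ 2 * ∫ x in S, |w - f x| ∂μ + η * μ.real S := by
  have hint : ∀ c : ℝ, Integrable (fun x => c - f x) (μ.restrict S) := fun c =>
    (integrable_const _).sub hf.integrableOn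
  have h1 : |∫ x in S, (v - f x) ∂μ - ∫ x in S, (w - f x) ∂μ| = μ.real S * |v - w| := by
    rw [← integral_sub (hint v) (hint w)]
    simp [abs_mul]
  have h2 : |∫ x in S, (w - f x) ∂μ| ≤ ∫ x in S, |w - f x| ∂μ := abs_integral_le_integral_abs
  have h3 := abs_setIntegral_sub_average_le hf hv
  have h4 : ∫ x in S, |v - f x| ∂μ ≤ ∫ x in S, (|v - w| + |w - f x|) ∂μ :=
    integral_mono (hint v).abs ((integrable_const _).add (hint w).abs)
      fun x => abs_sub_le _ _ _
  rw [integral_add (integrable_const _) (hint w).abs] at h4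
  simp only [integral_const, measureReal_restrict_apply_univ, smul_eq_mul] at h4
  have := abs_sub (∫ x in S, (v - f x) ∂μ) (∫ x in S, (w - f x) ∂μ)
  linarith

/-- A function whose integral nearly vanishes on every cell of a partition has small integral on
every set which splits only few cells. -/
lemma abs_setIntegral_preimage_cutIndex_le {ι κ : Type*} [Fintype ι] [Fintype κ] {μ : Measure ℝ}
    [IsFiniteMeasure μ] {g : ℝ → ℝ} (hg : Integrable g μ) (c : ι → ℝ) (e : κ → ℝ) (T : Set ℕ)
    {β η : ℝ} (hβ : 0 ≤ β)
    (h1 : ∀ j, ∫ x in cutIndex c ⁻¹' {j}, |g x| ∂μ ≤ β + η * μ.real (cutIndex c ⁻¹' {j}))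
    (h2 : ∀ j, |∫ x in cutIndex c ⁻¹' {j}, g x ∂μ| ≤ η * μ.real (cutIndex c ⁻¹' {j}))
    (hη : 0 ≤ η) :
    |∫ x in cutIndex (Sum.elim c e) ⁻¹' T, g x ∂μ| ≤ Fintype.card κ * β + η * μ.real univ := by
  classical
  set U := cutIndex (Sum.elim c e) ⁻¹' T with hU
  have hUm : MeasurableSet U := measurable_cutIndex _ (MeasurableSet.of_discrete)
  set N := Finset.range (Fintype.card ι + 1) with hN
  have hSm : ∀ j, MeasurableSet (cutIndex c ⁻¹' {j}) := fun j =>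
    measurable_cutIndex _ (MeasurableSet.of_discrete)
  have hdisj : ∀ i j, i ≠ j → Disjoint (cutIndex c ⁻¹' {i}) (cutIndex c ⁻¹' {j}) :=
    fun i j hij => Disjoint.preimage _ (by simpa using hij)
  have hcover : (⋃ j ∈ N, cutIndex c ⁻¹' {j}) = univ := by
    ext x
    simpa [hN] using cutIndex_lt c x
  set B := Finset.univ.image fun i => cutIndex c (e i) with hB
  have hterm : ∀ j, |∫ x in U ∩ cutIndex c ⁻¹' {j}, g x ∂μ| ≤
      (if j ∈ B then β else 0) + η * μ.real (cutIndex c ⁻¹' {j}) := by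
    intro j
    by_cases hj : j ∈ B
    · rw [if_pos hj]
      refine abs_integral_le_integral_abs.trans (le_trans ?_ (h1 j))
      exact setIntegral_mono_set hg.abs.integrableOn (ae_of_all _ fun x => abs_nonneg _)
        (LE.le.eventuallyLE inter_subset_right)
    · rw [if_neg hj, zero_add]
      have hconst : ∀ x ∈ cutIndex c ⁻¹' {j}, ∀ y ∈ cutIndex c ⁻¹' {j}, x ≤ y →
          cutIndex (Sum.elim c e) x = cutIndex (Sum.elim c e) y := by
        intro x hx y hy hxy
        refine (cutIndex_sum_eq_iff _).2 ⟨(hx : _ = j).trans (hy : _ = j).symm,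
          (cutIndex_eq_iff _ hxy).2 fun i hi => ?_⟩
        by_contra! hlt
        refine hj (Finset.mem_image.2 ⟨i, Finset.mem_univ i, le_antisymm ?_ ?_⟩)
        · exact (monotone_cutIndex c hlt.le).trans_eq hy
        · exact (hx : _ = j).symm.trans_le (monotone_cutIndex c hi)
      have hiff : ∀ x ∈ cutIndex c ⁻¹' {j}, ∀ y ∈ cutIndex c ⁻¹' {j}, x ∈ U → y ∈ U := by
        intro x hx y hy hxU
        have : cutIndex (Sum.elim c e) x = cutIndex (Sum.elim c e) y := by
          rcases le_total x y with h | h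
          · exact hconst x hx y hy h
          · exact (hconst y hy x hx h).symm
        rwa [hU, mem_preimage, ← this]
      rcases (U ∩ cutIndex c ⁻¹' {j}).eq_empty_or_nonempty with h | ⟨x, hxU, hx⟩
      · rw [h]
        simpa using mul_nonneg hη measureReal_nonneg
      · rw [inter_eq_self_of_subset_right fun y hy => hiff x hx y hy hxU]
        exact h2 j
  have hsplit : ∫ x in U, g x ∂μ = ∑ j ∈ N, ∫ x in U ∩ cutIndex c ⁻¹' {j}, g x ∂μ := by
    rw [← integral_biUnion_finset N (fun j _ => hUm.inter (hSm j))
      (fun i _ j _ hij => (hdisj i j hij).mono inter_subset_right inter_subset_right)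
      (fun j _ => hg.integrableOn), ← inter_iUnion₂, hcover, inter_univ]
  have hmass : ∑ j ∈ N, μ.real (cutIndex c ⁻¹' {j}) = μ.real univ := by
    rw [← hcover, measureReal_biUnion_finset (fun i _ j _ hij => hdisj i j hij)
      fun j _ => hSm j]
  have hbad : ∑ j ∈ N, (if j ∈ B then β else 0) ≤ Fintype.card κ * β := by
    rw [← Finset.sum_filter, Finset.sum_const, nsmul_eq_mul]
    have : (N.filter (· ∈ B)).card ≤ Fintype.card κ :=
      (Finset.card_le_card fun j hj => (Finset.mem_filter.1 hj).2).trans Finset.card_image_le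
    gcongr
  calc |∫ x in U, g x ∂μ| ≤ ∑ j ∈ N, |∫ x in U ∩ cutIndex c ⁻¹' {j}, g x ∂μ| :=
        hsplit ▸ Finset.abs_sum_le_sum_abs _ _
    _ ≤ ∑ j ∈ N, ((if j ∈ B then β else 0) + η * μ.real (cutIndex c ⁻¹' {j})) :=
        Finset.sum_le_sum fun j _ => hterm j
    _ ≤ Fintype.card κ * β + η * μ.real univ := by
        rw [Finset.sum_add_distrib, ← Finset.mul_sum, hmass]
        gcongr

/-- Refining a partition into `t + 1` cells by `r` further rational cut points and averaging `f`
on the cells of the refinement yields a function whose integrals over unions of few intervals are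
close to those of `f`. -/
lemma exists_rat_flattening {μ : Measure ℝ} [IsFiniteMeasure μ] [NullSingletonClass μ] {f : ℝ → ℝ}
    (hf : Integrable f μ) {t : ℕ} (d : Fin t → ℚ) (w : ℕ → ℝ) (r : ℕ) {η : ℝ} (hη : 0 < η) :
    ∃ (q : Fin r → ℚ) (v : ℕ →₀ ℚ), ∀ (s : ℕ) (e : Fin s → ℝ) (T : Set ℕ),
      |∫ x in cutIndex (Sum.elim (fun i => ((Sum.elim d q i : ℚ) : ℝ)) e) ⁻¹' T,
          ((v (cutIndex (fun i => ((Sum.elim d q i : ℚ) : ℝ)) x) : ℝ) - f x) ∂μ| ≤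
        s * (2 * ((∫ x, |w (cutIndex (fun i => (d i : ℝ)) x) - f x| ∂μ) / (r + 1) + η)) +
          η * μ.real univ := by
  set φ : ℝ → ℝ := fun x => |w (cutIndex (fun i => (d i : ℝ)) x) - f x| with hφ
  have hφi : Integrable φ μ := ((integrable_comp_cutIndex μ _ w).sub hf).abs
  have hφ0 : 0 ≤ᵐ[μ] φ := ae_of_all _ fun x => abs_nonneg _
  have := isFiniteMeasure_withDensity_ofReal hφi.2
  have : NullSingletonClass (μ.withDensity fun x => ENNReal.ofReal (φ x)) :=
    nullSingletonClass_withDensity _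
  obtain ⟨q, hq⟩ := exists_rat_cuts_measureReal_le
    (μ.withDensity fun x => ENNReal.ofReal (φ x)) r hη
  rw [measureReal_withDensity_ofReal hφi hφ0 MeasurableSet.univ, setIntegral_univ] at hq
  set c : Fin t ⊕ Fin r → ℝ := fun i => ((Sum.elim d q i : ℚ) : ℝ) with hc
  have hSm : ∀ j, MeasurableSet (cutIndex c ⁻¹' {j}) := fun j =>
    measurable_cutIndex _ (MeasurableSet.of_discrete)
  have hmass : ∀ j, ∫ x in cutIndex c ⁻¹' {j}, φ x ∂μ ≤ (∫ x, φ x ∂μ) / (r + 1) + η := by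
    intro j
    rw [← measureReal_withDensity_ofReal hφi hφ0 (hSm j)]
    refine hq _ (ordConnected_singleton.preimage_mono (monotone_cutIndex c))
      fun x hx y hy hxy i => ?_
    exact (cutIndex_eq_iff c hxy).1 ((hx : _ = j).trans (hy : _ = j).symm) (Sum.inr i)
  have hv : ∀ j : ℕ, ∃ v : ℚ, |(v : ℝ) - ⨍ x in cutIndex c ⁻¹' {j}, f x ∂μ| ≤ η := by
    intro j
    obtain ⟨v, hv1, hv2⟩ := exists_rat_btwn
      (lt_add_of_pos_right (⨍ x in cutIndex c ⁻¹' {j}, f x ∂μ) hη)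
    exact ⟨v, abs_le.2 ⟨by linarith, by linarith⟩⟩
  choose v hv using hv
  set m := Fintype.card (Fin t ⊕ Fin r) + 1 with hm
  refine ⟨q, Finsupp.onFinset (Finset.range m) (fun j => if j < m then v j else 0)
    fun j hj => Finset.mem_range.2 (by by_contra h; simp [h] at hj), fun s e T => ?_⟩
  have hval : ∀ x, Finsupp.onFinset (Finset.range m) (fun j => if j < m then v j else 0)
      (fun j hj => Finset.mem_range.2 (by by_contra h; simp [h] at hj)) (cutIndex c x) =
      v (cutIndex c x) := fun x => by
    rw [Finsupp.onFinset_apply, if_pos (cutIndex_lt c x)]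
  simp only [← hc, hval]
  have hcell : ∀ (j : ℕ) (F : ℝ → ℝ → ℝ),
      ∫ x in cutIndex c ⁻¹' {j}, F (v (cutIndex c x)) x ∂μ =
        ∫ x in cutIndex c ⁻¹' {j}, F (v j) x ∂μ := fun j F =>
    setIntegral_congr_fun (hSm j) fun x hx => by
      simp only [show cutIndex c x = j from hx]
  have h := abs_setIntegral_preimage_cutIndex_le (μ := μ) (β := 2 * ((∫ x, φ x ∂μ) / (r + 1) + η))
    (η := η) ((integrable_comp_cutIndex μ c fun j => (v j : ℝ)).sub hf) c e T
    (by have := integral_nonneg_of_ae hφ0; positivity) (fun j => ?_) (fun j => ?_) hη.le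
  · simpa using h
  · simp only [Pi.sub_apply]
    rw [hcell j fun v x => |v - f x|]
    rcases (cutIndex c ⁻¹' {j}).eq_empty_or_nonempty with h0 | ⟨y, hy⟩
    · have := integral_nonneg_of_ae hφ0
      rw [h0]
      simp only [Measure.restrict_empty, integral_zero_measure, measureReal_empty]
      positivity
    refine (setIntegral_abs_sub_average_le hf (hv j)
      (w (cutIndex (fun i => (d i : ℝ)) y))).trans ?_
    have hwy : ∫ x in cutIndex c ⁻¹' {j}, |w (cutIndex (fun i => (d i : ℝ)) y) - f x| ∂μ =
        ∫ x in cutIndex c ⁻¹' {j}, φ x ∂μ :=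
      setIntegral_congr_fun (hSm j) fun x hx => by
        have := ((cutIndex_sum_eq_iff c).1 ((hx : _ = j).trans (hy : _ = j).symm)).1
        simp only [hc, Sum.elim_inl] at this
        simp only [hφ, this]
    rw [hwy]
    linarith [hmass j]
  · simp only [Pi.sub_apply]
    rw [hcell j fun v x => v - f x]
    exact abs_setIntegral_sub_average_le hf (hv j)

lemma measureReal_densityMeasure {f : ℝ → ℝ} {I : Set ℝ} (hI : MeasurableSet I) (hf : IsPDFOn f I)
    {U : Set ℝ} (hU : MeasurableSet U) :
    (densityMeasure I f).real U = ∫ x in U, f x ∂(volume.restrict I) :=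
  measureReal_withDensity_ofReal hf.2.1
    ((ae_restrict_mem hI).mono fun x hx => hf.1 x hx) hU

lemma isProbabilityMeasure_densityMeasure {f : ℝ → ℝ} {I : Set ℝ} (hI : MeasurableSet I)
    (hf : IsPDFOn f I) : IsProbabilityMeasure (densityMeasure I f) := by
  have := measureReal_densityMeasure hI hf MeasurableSet.univ
  rw [setIntegral_univ, hf.2.2] at this
  exact ⟨(ENNReal.toReal_eq_one_iff _).1 this⟩

/-- A countable family of measurable criteria admits a measurable near-minimizer. -/
lemma exists_measurable_near_argmin {Ω H : Type*} [MeasurableSpace Ω] [Countable H] [Nonempty H]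
    {crit : Ω → H → ENNReal} (hcrit : ∀ i, Measurable fun X => crit X i) {η : ENNReal}
    (hη : η ≠ 0) :
    ∃ (u : ℕ → H) (N : Ω → ℕ), Measurable N ∧ ∀ X i, crit X (u (N X)) ≤ crit X i + η := by
  classical
  obtain ⟨u, hu⟩ := exists_surjective_nat H
  have hex : ∀ X, ∃ n, crit X (u n) ≤ (⨅ i, crit X i) + η := by
    intro X
    by_cases htop : (⨅ i, crit X i) = ⊤
    · exact ⟨0, by simp [htop]⟩
    · obtain ⟨i, hi⟩ := iInf_lt_iff.1 (ENNReal.lt_add_right htop hη)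
      obtain ⟨n, rfl⟩ := hu i
      exact ⟨n, hi.le⟩
  refine ⟨u, fun X => Nat.find (hex X), measurable_find hex fun n =>
    measurableSet_le (hcrit _) ((Measurable.iInf hcrit).add_const _), fun X i => ?_⟩
  exact (Nat.find_spec (hex X)).trans (by gcongr; exact iInf_le _ _)

/-- If the integrals of a histogram and of `f` nearly agree on all sets cut out by the break points
of the histogram and those of another one, then the `L¹` distance of the histogram to `f` is
controlled by that of the other one. -/
lemma integral_abs_comp_cutIndex_sub_le {ι κ : Type*} [Fintype ι] [Fintype κ] {μ : Measure ℝ}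
    [IsFiniteMeasure μ] {f : ℝ → ℝ} (hf : Integrable f μ) (c : ι → ℝ) (d : κ → ℝ) (v w : ℕ → ℝ)
    {K : ℝ} (h : ∀ T : Finset ℕ,
      |∫ x in cutIndex (Sum.elim c d) ⁻¹' T, (v (cutIndex c x) - f x) ∂μ| ≤ K) :
    ∫ x, |v (cutIndex c x) - f x| ∂μ ≤ 2 * K + 2 * ∫ x, |w (cutIndex d x) - f x| ∂μ := by
  classical
  have hg := integrable_comp_cutIndex μ c v
  have hg' := integrable_comp_cutIndex μ d w
  set g := fun x => v (cutIndex c x) with hgdef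
  set g' := fun x => w (cutIndex d x) with hgdef'
  have hgf : Integrable (fun x => g x - f x) μ := hg.sub hf
  have hg'f : Integrable (fun x => g' x - f x) μ := hg'.sub hf
  have hgg' : Integrable (fun x => g x - g' x) μ := hg.sub hg'
  set N := Finset.range (Fintype.card (ι ⊕ κ) + 1) with hN
  set T := N.filter fun k => ∃ x, cutIndex (Sum.elim c d) x = k ∧ g' x < g x with hT
  set U := cutIndex (Sum.elim c d) ⁻¹' T with hU
  have hUm : MeasurableSet U := measurable_cutIndex _ (MeasurableSet.of_discrete)
  have hmem : ∀ x, x ∈ U ↔ g' x < g x := by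
    intro x
    simp only [hU, hT, mem_preimage, SetLike.mem_coe, Finset.mem_filter]
    constructor
    · rintro ⟨-, y, hy, hlt⟩
      obtain ⟨h1, h2⟩ := (cutIndex_sum_eq_iff _).1 hy
      simp only [Sum.elim_inl, Sum.elim_inr] at h1 h2
      simpa only [hgdef, hgdef', h1, h2] using hlt
    · exact fun hlt => ⟨Finset.mem_range.2 (cutIndex_lt _ x), x, rfl, hlt⟩
  have hUc : Uᶜ = cutIndex (Sum.elim c d) ⁻¹' ((N \ T : Finset ℕ) : Set ℕ) := by
    ext x
    have := Nat.le_of_lt_succ (cutIndex_lt (Sum.elim c d) x)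
    rw [Fintype.card_sum] at this
    simp [hU, hN, this]
  have hsign : ∫ x, |g x - g' x| ∂μ = ∫ x in U, (g x - g' x) ∂μ - ∫ x in Uᶜ, (g x - g' x) ∂μ := by
    rw [← integral_add_compl hUm hgg'.abs, sub_eq_add_neg, ← integral_neg]
    congr 1
    · exact setIntegral_congr_fun hUm fun x hx => abs_of_pos (sub_pos.2 ((hmem x).1 hx))
    · exact setIntegral_congr_fun hUm.compl fun x hx =>
        abs_of_nonpos (sub_nonpos.2 (not_lt.1 fun hlt => hx ((hmem x).2 hlt)))
  have hpart : ∀ S : Set ℝ, ∫ x in S, (g x - g' x) ∂μ =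
      ∫ x in S, (g x - f x) ∂μ - ∫ x in S, (g' x - f x) ∂μ := by
    intro S
    rw [← integral_sub hgf.integrableOn hg'f.integrableOn]
    simp only [sub_sub_sub_cancel_right]
  have habs : ∀ S : Set ℝ, |∫ x in S, (g' x - f x) ∂μ| ≤ ∫ x in S, |g' x - f x| ∂μ :=
    fun S => abs_integral_le_integral_abs
  have hadd := integral_add_compl hUm hg'f.abs
  have htri : ∫ x, |g x - f x| ∂μ ≤ ∫ x, (|g x - g' x| + |g' x - f x|) ∂μ :=
    integral_mono hgf.abs (hgg'.abs.add hg'f.abs)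
      fun x => abs_sub_le _ _ _
  rw [integral_add hgg'.abs hg'f.abs, hsign, hpart, hpart] at htri
  have h1 := abs_le.1 (h T)
  have h2 := abs_le.1 (h (N \ T))
  rw [← hUc] at h2
  have h3 := abs_le.1 (habs U)
  have h4 := abs_le.1 (habs Uᶜ)
  linarith [h1.1, h1.2, h2.1, h2.2, h3.1, h3.2, h4.1, h4.2]

/-- The histogram with rational cut points `p.1` and rational values `p.2`. -/
noncomputable def ratHistogram {ι : Type*} [Fintype ι] (p : (ι → ℚ) × (ℕ →₀ ℚ)) (x : ℝ) : ℝ :=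
  (p.2 (cutIndex (fun i => (p.1 i : ℝ)) x) : ℝ)

/-- The union of the cells with index in `τ.2` of the partition cut by `c` and `τ.1`. -/
def testSet {ι κ : Type*} [Fintype ι] [Fintype κ] (c : ι → ℚ) (τ : (κ → ℚ) × Finset ℕ) : Set ℝ :=
  cutIndex (Sum.elim (fun i => (c i : ℝ)) fun k => (τ.1 k : ℝ)) ⁻¹' (τ.2 : Set ℕ)

/-- The largest deviation between the histogram `p` and the empirical measure of the sample `X`
over all test sets with `κ` additional cuts. -/
noncomputable def discrepancy {ι : Type*} (κ : Type*) [Fintype ι] [Fintype κ] (μ : Measure ℝ)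
    {n : ℕ} (X : Fin n → ℝ) (p : (ι → ℚ) × (ℕ →₀ ℚ)) : ENNReal :=
  ⨆ τ : (κ → ℚ) × Finset ℕ, ENNReal.ofReal
    |∫ x in testSet p.1 τ, ratHistogram p x ∂μ - empDev 0 X (testSet p.1 τ)|

section discrepancy

variable {ι κ : Type*} [Fintype ι] [Fintype κ]

lemma measurable_ratHistogram (p : (ι → ℚ) × (ℕ →₀ ℚ)) : Measurable (ratHistogram p) :=
  measurable_comp_cutIndex (fun i => (p.1 i : ℝ)) fun j => (p.2 j : ℝ)

lemma integrable_ratHistogram (μ : Measure ℝ) [IsFiniteMeasure μ] (p : (ι → ℚ) × (ℕ →₀ ℚ)) :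
    Integrable (ratHistogram p) μ :=
  integrable_comp_cutIndex μ (fun i => (p.1 i : ℝ)) fun j => (p.2 j : ℝ)

lemma measurableSet_testSet (c : ι → ℚ) (τ : (κ → ℚ) × Finset ℕ) : MeasurableSet (testSet c τ) :=
  measurable_cutIndex _ MeasurableSet.of_discrete

lemma measurable_discrepancy (μ : Measure ℝ) {n : ℕ} (p : (ι → ℚ) × (ℕ →₀ ℚ)) :
    Measurable fun X : Fin n → ℝ => discrepancy κ μ X p :=
  Measurable.iSup fun τ => ENNReal.measurable_ofReal.comp
    (measurable_const.sub (measurable_empDev 0 (measurableSet_testSet p.1 τ))).abs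

/-- On a sample whose empirical measure is uniformly close to `f`, any near-minimizer of the
discrepancy is nearly optimal. -/
lemma integral_abs_ratHistogram_sub_le {a b : ℝ} {f : ℝ → ℝ} (hf : IsPDFOn f (Icc a b)) {n : ℕ}
    {X : Fin n → ℝ} {ε₀ η K : ℝ} (hε₀ : 0 ≤ ε₀) (hη : 0 ≤ η) (hK : 0 ≤ K)
    (hX : ∀ (U : Set ℝ) (C : Finset ℝ), MeasurableSet U →
      C.card ≤ Fintype.card ι + Fintype.card κ → CutBy C U →
      |empDev (densityMeasure (Icc a b) f) X U| ≤ ε₀)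
    {p p₀ : (ι → ℚ) × (ℕ →₀ ℚ)} (hp : discrepancy κ (volume.restrict (Icc a b)) X p ≤
      discrepancy κ (volume.restrict (Icc a b)) X p₀ + ENNReal.ofReal η)
    (hp₀ : ∀ τ : (κ → ℚ) × Finset ℕ,
      |∫ x in testSet p₀.1 τ, (ratHistogram p₀ x - f x) ∂(volume.restrict (Icc a b))| ≤ K)
    (d : κ → ℚ) (w : ℕ → ℝ) :
    ∫ x in Icc a b, |ratHistogram p x - f x| ≤
      2 * (K + 2 * ε₀ + η) +
        2 * ∫ x in Icc a b, |w (cutIndex (fun k => (d k : ℝ)) x) - f x| := by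
  classical
  set μ := volume.restrict (Icc a b) with hμ
  have hdiff : ∀ (p : (ι → ℚ) × (ℕ →₀ ℚ)) (τ : (κ → ℚ) × Finset ℕ),
      ∫ x in testSet p.1 τ, (ratHistogram p x - f x) ∂μ =
        (∫ x in testSet p.1 τ, ratHistogram p x ∂μ - empDev 0 X (testSet p.1 τ)) +
          empDev (densityMeasure (Icc a b) f) X (testSet p.1 τ) := by
    intro p τ
    rw [integral_sub (integrable_ratHistogram μ p).integrableOn
      (show Integrable f μ from hf.2.1).integrableOn,
      ← measureReal_densityMeasure measurableSet_Icc hf (measurableSet_testSet p.1 τ)]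
    simp [empDev]
  have hdev : ∀ (p : (ι → ℚ) × (ℕ →₀ ℚ)) (τ : (κ → ℚ) × Finset ℕ),
      |empDev (densityMeasure (Icc a b) f) X (testSet p.1 τ)| ≤ ε₀ := fun p τ =>
    hX _ _ (measurableSet_testSet p.1 τ)
      (Finset.card_image_le.trans_eq (by rw [Finset.card_univ, Fintype.card_sum]))
      (cutBy_preimage_cutIndex _ _)
  have hcrit₀ : discrepancy κ μ X p₀ ≤ ENNReal.ofReal (K + ε₀) := by
    refine iSup_le fun τ => ENNReal.ofReal_le_ofReal ?_
    have h1 := abs_le.1 (hdev p₀ τ)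
    have h2 := abs_le.1 (hp₀ τ)
    rw [hdiff] at h2
    exact abs_le.2 ⟨by linarith [h1.2, h2.1], by linarith [h1.1, h2.2]⟩
  refine integral_abs_comp_cutIndex_sub_le hf.2.1 (fun i => (p.1 i : ℝ)) (fun k => (d k : ℝ))
    (fun j => (p.2 j : ℝ)) w fun T => ?_
  have h1 : ENNReal.ofReal
      |∫ x in testSet p.1 (d, T), ratHistogram p x ∂μ - empDev 0 X (testSet p.1 (d, T))| ≤
        ENNReal.ofReal (K + ε₀ + η) := by
    rw [ENNReal.ofReal_add (by positivity) hη]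
    exact (le_iSup (fun τ : (κ → ℚ) × Finset ℕ => ENNReal.ofReal
      |∫ x in testSet p.1 τ, ratHistogram p x ∂μ - empDev 0 X (testSet p.1 τ)|) (d, T)).trans
        (hp.trans (by gcongr))
  have h2 := (ENNReal.ofReal_le_ofReal_iff (by positivity)).1 h1
  have h3 := hdiff p (d, T)
  have h4 := hdev p (d, T)
  change |∫ x in testSet p.1 (d, T), (ratHistogram p x - f x) ∂μ| ≤ _
  rw [h3]
  linarith [abs_add_le (∫ x in testSet p.1 (d, T), ratHistogram p x ∂μ -
    empDev 0 X (testSet p.1 (d, T))) (empDev (densityMeasure (Icc a b) f) X (testSet p.1 (d, T)))]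

end discrepancy

/-- An estimator with `t + r + 1` pieces that is nearly optimal on every sample whose empirical
measure is uniformly close to the sampled density. -/
lemma exists_histogram_estimator {t : ℕ} (ht : 0 < t) (r n : ℕ) (a b : ℝ) {η : ℝ} (hη : 0 < η) :
    ∃ A : (Fin n → ℝ) → ℝ → ℝ, Measurable (fun p : (Fin n → ℝ) × ℝ => A p.1 p.2) ∧
      (∀ X, IsHistogram (Icc a b) (t + r + 1) (A X)) ∧
      ∀ (f : ℝ → ℝ) (X : Fin n → ℝ) (ε₀ : ℝ), IsPDFOn f (Icc a b) → a < b → 0 ≤ ε₀ →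
        (∀ (U : Set ℝ) (C : Finset ℝ), MeasurableSet U → C.card ≤ t + r + t → CutBy C U →
          |empDev (densityMeasure (Icc a b) f) X U| ≤ ε₀) →
        ∫ x in Icc a b, |A X x - f x| ≤ 2 * OPThist (Icc a b) t f +
          4 * t * OPThist (Icc a b) t f / (r + 1) + 4 * ε₀ + 3 * η := by
  set μ := volume.restrict (Icc a b) with hμ
  obtain ⟨u, N, hN, hu⟩ := exists_measurable_near_argmin
    (crit := fun (X : Fin n → ℝ) p => discrepancy (ι := Fin t ⊕ Fin r) (Fin t) μ X p)
    (measurable_discrepancy μ) (ENNReal.ofReal_pos.2 hη).ne'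
  refine ⟨fun X => ratHistogram (u (N X)), ?_, fun X => ?_, fun f X ε₀ hf hab hε₀ hX => ?_⟩
  · have h : Measurable fun p : ℕ × ℝ => ratHistogram (u p.1) p.2 :=
      measurable_from_prod_countable_right fun k => measurable_ratHistogram (u k)
    exact h.comp ((hN.comp measurable_fst).prodMk measurable_snd)
  · have h : IsHistogram (Icc a b) (Fintype.card (Fin t ⊕ Fin r) + 1) (ratHistogram (u (N X))) :=
      isHistogram_comp_cutIndex ordConnected_Icc (fun i => ((u (N X)).1 i : ℝ))
        fun j => ((u (N X)).2 j : ℝ)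
    simpa using h
  · have hD : 0 < 2 + 8 * (t : ℝ) + 2 * (b - a) := by have := sub_pos.2 hab; positivity
    obtain ⟨θ, hθ, hθη⟩ : ∃ θ : ℝ, 0 < θ ∧ θ * (2 + 8 * t + 2 * (b - a)) = η :=
      ⟨η / (2 + 8 * t + 2 * (b - a)), by positivity, div_mul_cancel₀ _ hD.ne'⟩
    obtain ⟨d, w, hdw⟩ := exists_rat_cutIndex_le_OPThist hab ht hf.2.1 hθ
    obtain ⟨q, v, hqv⟩ := exists_rat_flattening hf.2.1 d w r hθ
    set O := ∫ x in Icc a b, |w (cutIndex (fun i => (d i : ℝ)) x) - f x| with hO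
    have hO0 : 0 ≤ O := integral_nonneg fun x => abs_nonneg _
    have hvol : μ.real univ = b - a := by simp [hμ, hab.le]
    rw [← hμ, hvol] at hqv
    have hba := sub_pos.2 hab
    have key := integral_abs_ratHistogram_sub_le (ι := Fin t ⊕ Fin r) (κ := Fin t) hf hε₀ hη.le
      (K := t * (2 * (O / (r + 1) + θ)) + θ * (b - a)) (by positivity) (by simpa using hX)
      (p₀ := (Sum.elim d q, v)) (hu X (Sum.elim d q, v)) (fun τ => hqv t _ _) d w
    have hfrac : 4 * t * O / (r + 1) ≤ 4 * t * OPThist (Icc a b) t f / (r + 1) + 4 * t * θ := by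
      calc 4 * t * O / (r + 1) ≤ 4 * t * (OPThist (Icc a b) t f + θ) / (r + 1) := by gcongr
        _ = 4 * t * OPThist (Icc a b) t f / (r + 1) + 4 * t * θ / (r + 1) := by ring
        _ ≤ _ := by
          gcongr
          exact div_le_self (by positivity) (by linarith [(Nat.cast_nonneg r : (0 : ℝ) ≤ r)])
    calc ∫ x in Icc a b, |ratHistogram (u (N X)) x - f x|
        ≤ 2 * (t * (2 * (O / (r + 1) + θ)) + θ * (b - a) + 2 * ε₀ + η) + 2 * O := key
      _ = 2 * O + 4 * t * O / (r + 1) + 4 * ε₀ + 2 * η + θ * (4 * t + 2 * (b - a)) := by ring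
      _ ≤ _ := by linarith

/-- (Histogram merging theorem, statistical content) For every `α > 1` there is a constant
`C = C(α) > 0` such that: for every positive integer `t`, every `ε, δ ∈ (0,1)`, every
bounded interval `I = [a,b]`, and every `n ≥ C·(α·t + log(1/δ))/ε²`, there is a measurable
estimator `A` mapping `n` samples to a piecewise constant function with at most `2αt`
pieces such that for every pdf `f` on `I`, with probability at least `1 − δ` over `n`
i.i.d. samples from `f`, the hypothesis `h = A(X)` satisfies
`∫_I |h − f| ≤ 2·OPT_t(f) + (4·OPT_t(f) + 4ε)/(α − 1) + ε`. -/
theorem stmt18 : ∀ α : ℝ, 1 < α → ∃ C : ℝ, 0 < C ∧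
    ∀ (t : ℕ) (ε δ a b : ℝ) (n : ℕ),
      0 < t → 0 < ε → ε < 1 → 0 < δ → δ < 1 → a ≤ b →
      C * ((α * (t : ℝ) + Real.log (1 / δ)) / ε ^ 2) ≤ (n : ℝ) →
      ∃ A : (Fin n → ℝ) → ℝ → ℝ,
        Measurable (fun p : (Fin n → ℝ) × ℝ => A p.1 p.2) ∧
        (∀ X, ∃ m : ℕ, (m : ℝ) ≤ 2 * α * (t : ℝ) ∧ IsHistogram (Set.Icc a b) m (A X)) ∧
        ∀ f : ℝ → ℝ, IsPDFOn f (Set.Icc a b) →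
          ENNReal.ofReal (1 - δ) ≤
            (Measure.pi fun _ : Fin n => densityMeasure (Set.Icc a b) f)
              {X | (∫ x in Set.Icc a b, |A X x - f x|) ≤
                2 * OPThist (Set.Icc a b) t f +
                  (4 * OPThist (Set.Icc a b) t f + 4 * ε) / (α - 1) + ε} := by
  intro α hα
  refine ⟨16896 * 192, by norm_num, fun t ε δ a b n ht hε hε1 hδ hδ1 hab hn => ?_⟩
  have ht1 : (1 : ℝ) ≤ t := by exact_mod_cast ht
  have hαt : (t : ℝ) ≤ α * t := le_mul_of_one_le_left (by positivity) hα.le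
  have hlog : 0 ≤ Real.log (1 / δ) := Real.log_nonneg (by rw [le_div_iff₀ hδ]; linarith)
  obtain ⟨r, hr⟩ : ∃ r, ⌊2 * α * (t : ℝ)⌋₊ = t + r + 1 :=
    le_iff_exists_add.1 (Nat.le_floor (by push_cast; linarith) : t + 1 ≤ ⌊2 * α * (t : ℝ)⌋₊) |>.imp
      fun r hr => by omega
  have hr1 : (t : ℝ) + r + 1 ≤ 2 * α * t := by
    have := Nat.floor_le (show 0 ≤ 2 * α * (t : ℝ) by positivity)
    rw [hr] at this
    exact_mod_cast this
  have hr2 : 2 * α * t < (t : ℝ) + r + 1 + 1 := by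
    have := Nat.lt_floor_add_one (2 * α * (t : ℝ))
    rw [hr] at this
    exact_mod_cast this
  obtain ⟨A, hA, hAhist, hAerr⟩ := exists_histogram_estimator ht r n a b
    (show 0 < ε / 6 by positivity)
  refine ⟨A, hA, fun X => ⟨t + r + 1, by exact_mod_cast hr1, hAhist X⟩, fun f hf => ?_⟩
  have hlt : a < b := by
    refine hab.lt_of_ne fun h => ?_
    have := hf.2.2
    simp [h] at this
  have := isProbabilityMeasure_densityMeasure measurableSet_Icc hf
  have : NullSingletonClass (densityMeasure (Icc a b) f) := nullSingletonClass_withDensity _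
  set L := ⌈Real.log (1 / δ)⌉₊ with hL
  have hL1 : (L : ℝ) < Real.log (1 / δ) + 1 := Nat.ceil_lt_add_one hlog
  have hM : ((t + r + t + L : ℕ) : ℝ) ≤ 3 * (α * t + Real.log (1 / δ)) := by
    push_cast
    linarith
  obtain ⟨G, hG, hGc, hdev⟩ := exists_uniform_deviation_event (densityMeasure (Icc a b) f)
    (M := t + r + t + L) (n := n) (by omega) (show 0 < ε / 8 by positivity) (by linarith) <| by
      refine le_trans ?_ hn
      calc 16896 * ((t + r + t + L : ℕ) : ℝ) / (ε / 8) ^ 2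
          = 16896 * 64 * (((t + r + t + L : ℕ) : ℝ) / ε ^ 2) := by field_simp; ring
        _ ≤ 16896 * 64 * (3 * (α * t + Real.log (1 / δ)) / ε ^ 2) := by gcongr
        _ = _ := by ring
  have hexp : Real.exp (-((t + r + t + L : ℕ) : ℝ)) ≤ δ := by
    rw [← Real.le_log_iff_exp_le hδ]
    have h1 : Real.log (1 / δ) ≤ L := Nat.le_ceil _
    have h2 : (L : ℝ) ≤ ((t + r + t + L : ℕ) : ℝ) := by exact_mod_cast Nat.le_add_left _ _
    rw [one_div, Real.log_inv] at h1
    linarith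
  calc ENNReal.ofReal (1 - δ)
      ≤ (Measure.pi fun _ : Fin n => densityMeasure (Icc a b) f) G := by
        rw [ENNReal.ofReal_le_iff_le_toReal (measure_ne_top _ _)]
        have h := probReal_compl_eq_one_sub
          (μ := Measure.pi fun _ : Fin n => densityMeasure (Icc a b) f) hG
        change 1 - δ ≤ (Measure.pi fun _ : Fin n => densityMeasure (Icc a b) f).real G
        linarith
    _ ≤ _ := by
        refine measure_mono fun X hX => ?_
        have herr := hAerr f X (ε / 8) hf hlt (by positivity) fun U C hU hC hcut =>
          hdev X hX U C hU (hC.trans (Nat.le_add_right _ _)) hcut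
        have hOPT : 0 ≤ OPThist (Icc a b) t f := Real.sInf_nonneg <| by
          rintro _ ⟨g, -, -, rfl⟩
          exact integral_nonneg fun x => abs_nonneg _
        have hα0 : 0 < α - 1 := sub_pos.2 hα
        have hfrac : 4 * t * OPThist (Icc a b) t f / (r + 1) ≤
            4 * OPThist (Icc a b) t f / (α - 1) := by
          rw [div_le_div_iff₀ (by positivity) hα0]
          have : (α - 1) * t ≤ r + 1 := by linarith
          calc 4 * t * OPThist (Icc a b) t f * (α - 1)
              = 4 * OPThist (Icc a b) t f * ((α - 1) * t) := by ring
            _ ≤ _ := by gcongr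
        have hε4 : 0 ≤ 4 * ε / (α - 1) := by positivity
        rw [mem_ofPred_eq, add_div]
        linarith
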